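/- For odd n, a cyclic code I in (ℤ/4)[x]/(xⁿ-1) is a free ℤ/4-module if and only if I is generated by (the image of) a monic divisor p(x) of xⁿ-1 in (ℤ/4)[x], in which case its rank is n - deg p. -/

import Mathlib

open Polynomial

namespace FreeCyclicAux

instance nontrivial_four : Nontrivial (ZMod 4) := ⟨0, 1, by decide⟩

lemma C_two : C (2 : ZMod 4) = 2 := map_ofNat C 2

lemma four_eq_zero : (4 : (ZMod 4)[X]) = 0 := by
  have h : (4 : ZMod 4) = 0 := by decide
  rw [← map_ofNat (C : ZMod 4 →+* (ZMod 4)[X]) 4, h, map_zero]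

/-- Reduction of coefficients mod two. -/
noncomputable abbrev red : (ZMod 4)[X] →+* (ZMod 2)[X] :=
  mapRingHom (ZMod.castHom (by norm_num : 2 ∣ 4) (ZMod 2))

lemma red_surj : Function.Surjective red :=
  Polynomial.map_surjective _ (ZMod.castHom_surjective _)

lemma red_zero {f : (ZMod 4)[X]} (h : red f = 0) : ∃ s, f = 2 * s := by
  have h1 : C (2 : ZMod 4) ∣ f := by
    rw [C_dvd_iff_dvd_coeff]
    intro i
    have h2 : ZMod.castHom (by norm_num : 2 ∣ 4) (ZMod 2) (f.coeff i) = 0 := by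
      have := congrArg (fun q => coeff q i) h
      simpa [red] using this
    revert h2
    generalize f.coeff i = a
    revert a
    decide
  rw [C_two] at h1
  exact h1

lemma free_prop {M : Type*} [AddCommGroup M] [Module (ZMod 4) M] [Module.Free (ZMod 4) M]
    (y : M) (hy : (2 : ZMod 4) • y = 0) : ∃ z : M, y = (2 : ZMod 4) • z := by
  let b := Module.Free.chooseBasis (ZMod 4) M
  let g : ZMod 4 → ZMod 4 := fun a => if a = 2 then 1 else 0
  refine ⟨b.repr.symm ((b.repr y).mapRange g (by decide)), ?_⟩
  apply b.repr.injective
  ext i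
  have h : 2 * b.repr y i = 0 := by
    have := congrArg (fun m => b.repr m i) hy
    simpa using this
  simp only [map_smul, LinearEquiv.apply_symm_apply, Finsupp.smul_apply, Finsupp.mapRange_apply,
    smul_eq_mul]
  revert h
  generalize b.repr y i = a
  simp only [g]
  revert a
  decide

lemma exists_gen (J : Ideal (ZMod 4)[X]) (f : (ZMod 4)[X]) (hf : f.Monic) (hfJ : f ∈ J)
    (hP : ∀ z, 2 * z ∈ J → ∃ j ∈ J, 2 * z = 2 * j) :
    ∃ p : (ZMod 4)[X], p.Monic ∧ J = Ideal.span {p} := by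
  obtain ⟨g0, hg0⟩ := (IsPrincipalIdealRing.principal (J.map red)).principal
  have hmem : ∀ j ∈ J, g0 ∣ red j := by
    intro j hj
    rw [← Ideal.mem_span_singleton]
    have := Ideal.mem_map_of_mem red hj
    rwa [hg0] at this
  have hg0ne : g0 ≠ 0 := by
    rintro rfl
    have h1 := hmem f hfJ
    rw [zero_dvd_iff] at h1
    exact (hf.map _).ne_zero h1
  have hg0m : g0.Monic := by
    have h1 : g0.leadingCoeff ≠ 0 := by simpa using hg0ne
    have : ∀ a : ZMod 2, a ≠ 0 → a = 1 := by decide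
    exact this _ h1
  have hg0J : g0 ∈ J.map red := by
    rw [hg0]; exact Ideal.mem_span_singleton_self _
  obtain ⟨p0, hp0, hp0g⟩ := (Ideal.mem_map_iff_of_surjective red red_surj).1 hg0J
  obtain ⟨g, hg, hgd, hgm⟩ := lifts_and_degree_eq_and_monic
    (f := ZMod.castHom (by norm_num : 2 ∣ 4) (ZMod 2)) (p := g0)
    ((mem_lifts _).2 (red_surj g0)) hg0m
  have hg' : red g = g0 := hg
  obtain ⟨h, hh⟩ := red_zero (f := p0 - g) (by rw [map_sub, hp0g, hg', sub_self])
  have two_red : ∀ t, red (2 * t) = 0 := by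
    intro t
    have : (2 : (ZMod 2)[X]) = 0 := CharTwo.two_eq_zero
    rw [map_mul, map_ofNat, this, zero_mul]
  have h4 := four_eq_zero
  have hgJ : 2 * g ∈ J := by
    have : 2 * g = 2 * p0 := by linear_combination (-2) * hh - h * h4
    rw [this]; exact J.mul_mem_left _ hp0
  obtain ⟨p, hpJ, hpm, hpr⟩ : ∃ p ∈ J, p.Monic ∧ red p = g0 := by
    refine ⟨g + 2 * (h %ₘ g), ?_, ?_, ?_⟩
    · have h1 := modByMonic_add_div h g
      have : g + 2 * (h %ₘ g) = p0 - (h /ₘ g) * (2 * g) := by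
        linear_combination 2 * h1 - hh
      rw [this]
      exact J.sub_mem hp0 (J.mul_mem_left _ hgJ)
    · apply hgm.add_of_left
      have h1 := degree_modByMonic_lt h hgm
      have h2 : (2 * (h %ₘ g)).degree ≤ (h %ₘ g).degree := by
        have := degree_smul_le (2 : ZMod 4) (h %ₘ g)
        rwa [smul_eq_C_mul, C_two] at this
      exact h2.trans_lt h1
    · rw [map_add, two_red, add_zero, hg']
  have hpdvd : ∀ j ∈ J, ∃ c t, j = p * c + 2 * t := by
    intro j hj
    obtain ⟨c0, hc0⟩ := hmem j hj
    obtain ⟨c, rfl⟩ := red_surj c0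
    obtain ⟨t, ht⟩ := red_zero (f := j - p * c) (by rw [map_sub, map_mul, hpr, hc0, sub_self])
    exact ⟨c, t, by linear_combination ht⟩
  refine ⟨p, hpm, le_antisymm ?_ ((Ideal.span_singleton_le_iff_mem _).2 hpJ)⟩
  intro j hj
  rw [Ideal.mem_span_singleton]
  obtain ⟨c, t, hc⟩ := hpdvd j hj
  have ht : 2 * t ∈ J := by
    have : 2 * t = j - c * p := by linear_combination -hc
    rw [this]; exact J.sub_mem hj (J.mul_mem_left _ hpJ)
  obtain ⟨k, hk, hk2⟩ := hP t ht
  obtain ⟨c', t', hc'⟩ := hpdvd k hk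
  exact ⟨c + 2 * c', by linear_combination hc + hk2 + 2 * hc' + t' * h4⟩

lemma span_free (p q : (ZMod 4)[X]) (hp : p.Monic) (hq : q.Monic) :
    Module.Free (ZMod 4) (Ideal.span {Ideal.Quotient.mk (Ideal.span {p * q}) p}) ∧
    Module.rank (ZMod 4) (Ideal.span {Ideal.Quotient.mk (Ideal.span {p * q}) p})
      = (q.natDegree : ℕ) := by
  let K := Ideal.span {p * q}
  let φ : (ZMod 4)[X] →ₗ[(ZMod 4)[X]] ((ZMod 4)[X] ⧸ K) :=
    LinearMap.toSpanSingleton _ _ (Ideal.Quotient.mk K p)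
  have hφ : ∀ x, φ x = Ideal.Quotient.mk K (x * p) := by
    intro x
    rfl
  have hker : LinearMap.ker φ = Ideal.span {q} := by
    ext x
    rw [LinearMap.mem_ker, hφ, Ideal.Quotient.eq_zero_iff_mem, Ideal.mem_span_singleton,
      Ideal.mem_span_singleton, mul_comm x p]
    exact hp.isRegular.left.dvd_cancel_left
  have hrange : ∀ y, y ∈ LinearMap.range φ ↔ y ∈ Ideal.span {Ideal.Quotient.mk K p} := by
    intro y
    rw [Ideal.mem_span_singleton']
    constructor
    · rintro ⟨x, rfl⟩
      exact ⟨Ideal.Quotient.mk K x, by rw [hφ, map_mul]⟩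
    · rintro ⟨a, rfl⟩
      obtain ⟨x, rfl⟩ := Ideal.Quotient.mk_surjective a
      exact ⟨x, by rw [hφ, map_mul]⟩
  let e1 : ((ZMod 4)[X] ⧸ Ideal.span {q}) ≃ₗ[(ZMod 4)[X]] LinearMap.range φ :=
    (Submodule.quotEquivOfEq _ _ hker.symm).trans φ.quotKerEquivRange
  let e2 : AdjoinRoot q ≃ₗ[ZMod 4] LinearMap.range φ := e1.restrictScalars (ZMod 4)
  let e3 : LinearMap.range φ ≃ₗ[ZMod 4] (Ideal.span {Ideal.Quotient.mk K p}) :=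
    { toFun := fun y => ⟨y.1, (hrange _).1 y.2⟩
      invFun := fun y => ⟨y.1, (hrange _).2 y.2⟩
      map_add' := fun _ _ => rfl
      map_smul' := fun _ _ => rfl
      left_inv := fun _ => rfl
      right_inv := fun _ => rfl }
  let b := (AdjoinRoot.powerBasis' hq).basis.map (e2.trans e3)
  refine ⟨Module.Free.of_basis b, ?_⟩
  rw [rank_eq_card_basis b]
  simp

end FreeCyclicAux

open FreeCyclicAux in
theorem free_cyclic_iff (n : ℕ) (hn : Odd n) (hpos : 0 < n)
    (I : Ideal (Polynomial (ZMod 4) ⧸ Ideal.span {(X ^ n - 1 : Polynomial (ZMod 4))})) :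
    Module.Free (ZMod 4) I ↔
      ∃ p : Polynomial (ZMod 4), p.Monic ∧ p ∣ (X ^ n - 1 : Polynomial (ZMod 4)) ∧
        I = Ideal.span
          {Ideal.Quotient.mk (Ideal.span {(X ^ n - 1 : Polynomial (ZMod 4))}) p} ∧
        Module.rank (ZMod 4) I = (n - p.natDegree : ℕ) := by
  have hfm : (X ^ n - 1 : (ZMod 4)[X]).Monic := by
    simpa using monic_X_pow_sub_C (1 : ZMod 4) hpos.ne'
  have hfd : (X ^ n - 1 : (ZMod 4)[X]).natDegree = n := by
    simpa using natDegree_X_pow_sub_C (n := n) (r := (1 : ZMod 4))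
  generalize (X ^ n - 1 : (ZMod 4)[X]) = f at *
  have key : ∀ p : (ZMod 4)[X], p.Monic → p ∣ f →
      I = Ideal.span {Ideal.Quotient.mk (Ideal.span {f}) p} →
      Module.Free (ZMod 4) I ∧ Module.rank (ZMod 4) I = (n - p.natDegree : ℕ) := by
    rintro p hp ⟨q, rfl⟩ rfl
    have hq : q.Monic := hp.of_mul_monic_left hfm
    have := span_free p q hp hq
    rw [hp.natDegree_mul hq] at hfd
    rwa [← hfd, Nat.add_sub_cancel_left]
  constructor
  · intro hfree
    let π := Ideal.Quotient.mk (Ideal.span {f})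
    have hfJ : f ∈ I.comap π := by
      have : π f = 0 := Ideal.Quotient.eq_zero_iff_mem.2 (Ideal.mem_span_singleton_self f)
      rw [Ideal.mem_comap, this]
      exact I.zero_mem
    have h4 := four_eq_zero
    have h2s : ∀ y : (ZMod 4)[X] ⧸ Ideal.span {f}, (2 : ZMod 4) • y = 2 * y := by
      intro y
      rw [two_smul, two_mul]
    obtain ⟨p, hp, hJ⟩ := exists_gen (I.comap π) f hfm hfJ (by
      intro z hz
      obtain ⟨⟨w, hw⟩, hw2⟩ := free_prop (M := I) ⟨π (2 * z), hz⟩ (by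
        apply Subtype.ext
        change (2 : ZMod 4) • π (2 * z) = 0
        rw [h2s]
        have : (2 : (ZMod 4)[X] ⧸ Ideal.span {f}) * π (2 * z) = π (4 * z) := by
          simp only [map_mul, map_ofNat]; ring
        rw [this, h4, zero_mul, map_zero])
      obtain ⟨j, rfl⟩ := Ideal.Quotient.mk_surjective w
      have h1 : π (2 * z) = (2 : ZMod 4) • π j := congrArg Subtype.val hw2
      have h3 : π (2 * z) = π (2 * j) := by
        rw [h1, h2s, map_mul π 2 j, map_ofNat]
      obtain ⟨t, ht⟩ := Ideal.mem_span_singleton.1 (Ideal.Quotient.eq.1 h3)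
      have h5 : red t = 0 := by
        have h6 := congrArg red ht
        have : (2 : (ZMod 2)[X]) = 0 := CharTwo.two_eq_zero
        rw [map_sub, map_mul, map_mul, map_mul, map_ofNat, this, zero_mul, zero_mul, sub_zero] at h6
        rcases mul_eq_zero.1 h6.symm with h7 | h7
        · exact absurd h7 (hfm.map _).ne_zero
        · exact h7
      obtain ⟨s, rfl⟩ := red_zero h5
      exact ⟨j + f * s, Ideal.add_mem _ hw (Ideal.mul_mem_right _ _ hfJ),
        by linear_combination ht⟩)
    have hd : p ∣ f := by
      rw [← Ideal.mem_span_singleton, ← hJ]; exact hfJ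
    have hI : I = Ideal.span {π p} := by
      rw [← Ideal.map_comap_of_surjective π Ideal.Quotient.mk_surjective I, hJ, Ideal.map_span,
        Set.image_singleton]
    exact ⟨p, hp, hd, hI, (key p hp hd hI).2⟩
  · rintro ⟨p, hp, hd, hI, -⟩
    exact (key p hp hd hI).1
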